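/- arXiv:2207.10371 — 2 statements merged into one kernel-verified Lean document; each statement's English description precedes it below -/
import Mathlib

section
/- For all real numbers H > 0, u > 0 and u₀ > 0: Real.arctan ( H / Real.sqrt u ) ≥ Real.arctan ( H / Real.sqrt u₀ ) − H · (u − u₀) / ( 2 · Real.sqrt u₀ · (H² + u₀) ). -/
theorem hasDerivAt_arctan_div_sqrt (H : ℝ) {u : ℝ} (hu : 0 < u) :
    HasDerivAt (fun u => Real.arctan (H / Real.sqrt u))
      (-(H / (2 * Real.sqrt u * (H ^ 2 + u)))) u := by
  have hs : 0 < Real.sqrt u := Real.sqrt_pos.2 hu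
  have hsq : Real.sqrt u ^ 2 = u := Real.sq_sqrt hu.le
  have h := ((hasDerivAt_const u H).fun_div (Real.hasDerivAt_sqrt hu.ne') hs.ne').arctan
  convert h using 1
  rw [div_pow, hsq]
  field_simp
  ring

theorem convexOn_arctan_div_sqrt {H : ℝ} (hH : 0 ≤ H) :
    ConvexOn ℝ (Set.Ioi 0) (fun u => Real.arctan (H / Real.sqrt u)) := by
  refine MonotoneOn.convexOn_of_deriv (convex_Ioi 0)
    (fun u hu => (hasDerivAt_arctan_div_sqrt H hu).continuousAt.continuousWithinAt) ?_ ?_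
  all_goals rw [interior_Ioi]
  · exact fun u hu =>
      (hasDerivAt_arctan_div_sqrt H hu).differentiableAt.differentiableWithinAt
  · intro u hu v hv huv
    have hu_pos : 0 < u := hu
    rw [(hasDerivAt_arctan_div_sqrt H hu).deriv, (hasDerivAt_arctan_div_sqrt H hv).deriv]
    gcongr

/-- First-order Taylor lower bound of the convex function `u ↦ arctan (H/√u)`
at the reference point `u₀`. -/
theorem stmt_5 (H u u₀ : ℝ) (hH : 0 < H) (hu : 0 < u) (hu₀ : 0 < u₀) :
    Real.arctan (H / Real.sqrt u) ≥
      Real.arctan (H / Real.sqrt u₀) -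
        H * (u - u₀) / (2 * Real.sqrt u₀ * (H ^ 2 + u₀)) := by
  have hc := convexOn_arctan_div_sqrt hH.le
  have hd := hasDerivAt_arctan_div_sqrt H hu₀
  rw [mul_div_right_comm]
  rcases lt_trichotomy u u₀ with h | rfl | h
  · have hs := hc.slope_le_of_hasDerivAt hu hu₀ h hd
    rw [slope_def_field, div_le_iff₀ (sub_pos.2 h)] at hs
    linarith
  · simp
  · have hs := hc.le_slope_of_hasDerivAt hu₀ hu h hd
    rw [slope_def_field, le_div_iff₀ (sub_pos.2 h)] at hs
    linarith
end

section
/- Fix K ≥ 1, reals c₀ ∈ ℝ, H > 0, A ≥ 0, B ≥ 0, points g_1, …, g_K of the Euclidean plane ℝ², positive reals u₀_1, …, u₀_K, and nonpositive reals O_1, …, O_K ≤ 0 and G_1, …, G_K ≤ 0. Then the function q ↦ c₀ + Σ_{i=1}^{K} O_i · ( ‖q − g_i‖² + H² ) + Σ_{i=1}^{K} G_i · ( 1 + A · Real.exp ( −B · ( (180/π) · ( Real.arctan ( H / Real.sqrt u₀_i ) − H·( ‖q − g_i‖² − u₀_i ) / ( 2 · Real.sqrt u₀_i · (H² + u₀_i)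 ) ) − A ) ) ) is concave on all of ℝ². -/
open Real

theorem convexOn_norm_sub_sq {E : Type*} [SeminormedAddCommGroup E] [NormedSpace ℝ E] (c : E) :
    ConvexOn ℝ Set.univ (fun x : E => ‖x - c‖ ^ 2) := by
  simpa [dist_eq_norm] using! (convexOn_univ_dist c).pow (fun _ _ => dist_nonneg) 2

theorem ConvexOn.exp_comp {E : Type*} [AddCommMonoid E] [Module ℝ E] {s : Set E} {f : E → ℝ}
    (hf : ConvexOn ℝ s f) : ConvexOn ℝ s (fun x => Real.exp (f x)) :=
  ⟨hf.1, fun _ hx _ hy _ _ ha hb hab =>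
    (Real.exp_le_exp.2 (hf.2 hx hy ha hb hab)).trans
      (convexOn_exp.2 (Set.mem_univ _) (Set.mem_univ _) ha hb hab)⟩

theorem concaveOn_finset_sum {ι E : Type*} [AddCommMonoid E] [Module ℝ E] {s : Set E}
    (hs : Convex ℝ s) (t : Finset ι) {f : ι → E → ℝ} (hf : ∀ i ∈ t, ConcaveOn ℝ s (f i)) :
    ConcaveOn ℝ s (fun x => ∑ i ∈ t, f i x) := by
  refine ⟨hs, fun x hx y hy a b ha hb hab => ?_⟩
  simp only [Finset.smul_sum, ← Finset.sum_add_distrib]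
  exact Finset.sum_le_sum fun i hi => (hf i hi).2 hx hy ha hb hab

theorem ConvexOn.const_mul_of_nonpos {E : Type*} [AddCommMonoid E] [Module ℝ E] {s : Set E}
    {f : E → ℝ} (hf : ConvexOn ℝ s f) {c : ℝ} (hc : c ≤ 0) :
    ConcaveOn ℝ s (fun x => c * f x) := by
  refine (hf.smul (neg_nonneg.2 hc)).neg.congr fun x _ => ?_
  simp

open Real

/-- Equation (46): the refined lower bound `R̆^{llb}_{1m}[n]` — a constant plus
nonpositive multiples of `‖q − g_i‖² + H²` and of the convex upper bounds
`Y^{up}_{m,i}(q)` — is a concave function of the UAV position `q` on all of ℝ². -/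
theorem stmt_15 (K : ℕ) (hK : 1 ≤ K) (c₀ H A B : ℝ) (hH : 0 < H) (hA : 0 ≤ A)
    (hB : 0 ≤ B) (g : Fin K → EuclideanSpace ℝ (Fin 2)) (u₀ : Fin K → ℝ)
    (hu₀ : ∀ i, 0 < u₀ i) (O G : Fin K → ℝ) (hO : ∀ i, O i ≤ 0) (hG : ∀ i, G i ≤ 0) :
    ConcaveOn ℝ Set.univ (fun q : EuclideanSpace ℝ (Fin 2) =>
      c₀ + ∑ i, O i * (‖q - g i‖ ^ 2 + H ^ 2) +
        ∑ i, G i * (1 + A * Real.exp (-B * ((180 / π) *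
          (Real.arctan (H / Real.sqrt (u₀ i)) -
            H * (‖q - g i‖ ^ 2 - u₀ i) /
              (2 * Real.sqrt (u₀ i) * (H ^ 2 + u₀ i))) - A)))) := by
  have hsum₁ : ConcaveOn ℝ Set.univ (fun q : EuclideanSpace ℝ (Fin 2) =>
      ∑ i, O i * (‖q - g i‖ ^ 2 + H ^ 2)) :=
    concaveOn_finset_sum convex_univ _ fun i _ =>
      ((convexOn_norm_sub_sq (g i)).add_const (H ^ 2)).const_mul_of_nonpos (hO i)
  refine (((concaveOn_const c₀ convex_univ).add hsum₁).add
    (concaveOn_finset_sum convex_univ _ fun i _ => ConvexOn.const_mul_of_nonpos ?_ (hG i)))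
  refine (convexOn_const 1 convex_univ).add (ConvexOn.smul hA (ConvexOn.exp_comp ?_))
  have hu := hu₀ i
  have hslope : 0 ≤ B * (180 / π) * (H / (2 * √(u₀ i) * (H ^ 2 + u₀ i))) := by positivity
  refine (((convexOn_norm_sub_sq (g i)).smul hslope).add_const
    (-B * ((180 / π) * (Real.arctan (H / √(u₀ i)) +
      H * u₀ i / (2 * √(u₀ i) * (H ^ 2 + u₀ i))) - A))).congr fun q _ => ?_
  simp only [smul_eq_mul, Pi.add_apply]
  ring
end
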